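/- There exist M₀ ∈ ℕ and c₄ ∈ (0,∞) such that for every integer M ≥ M₀, every n ∈ ℕ, and every real y ∈ [0, √n], the probability that sup over τ_{Mn}^𝔅 ≤ i ≤ τ_{(M+1)n}^𝔅 of |𝔇_i − 𝔇_{τ_{Mn}^𝔅}| is at least y·√n is at most (1/c₄)·exp(−c₄·y²). -/

import Mathlib

open MeasureTheory ProbabilityTheory Filter

/-- The asymptotic condition `1/w(n) = n^α (1 + 2B/n + O(1/n²))` on the weight function. -/
def WeightAsymp (w : ℕ → ℝ) (α B : ℝ) : Prop :=
  ∃ C₀ > (0:ℝ), ∃ N₀ : ℕ, ∀ n : ℕ, N₀ ≤ n →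
    |1 / w n - (n:ℝ) ^ α - 2 * B * (n:ℝ) ^ (α - 1)| ≤ C₀ * (n:ℝ) ^ (α - 2)

/-- The three admissible choices of `(b, r)` in terms of the weight function `w`. -/
def UrnChoice (w b r : ℕ → ℝ) : Prop :=
  (∀ i, b i = w (2*i) ∧ r i = w (2*i+1)) ∨
  (∀ i, b i = w (2*i+1) ∧ r i = w (2*i)) ∨
  (∀ i, b i = w (2*i) ∧ r i = w (2*i))

/-- A generalized Pólya urn process: `Bl n` and `Re n` are the numbers of blue and red
balls drawn in the first `n` draws; started at `(0,0)`, exactly one coordinate increases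
by `1` at each step, and conditionally on the past the blue coordinate increases with
probability `b(Bl n)/(b(Bl n) + r(Re n))`. -/
structure Urn {Ω : Type*} [MeasurableSpace Ω] (μ : Measure Ω) (b r : ℕ → ℝ) where
  Bl : ℕ → Ω → ℕ
  Re : ℕ → Ω → ℕ
  meas_Bl : ∀ n, Measurable (Bl n)
  meas_Re : ∀ n, Measurable (Re n)
  init_Bl : ∀ ω, Bl 0 ω = 0
  init_Re : ∀ ω, Re 0 ω = 0
  step : ∀ n ω, (Bl (n+1) ω = Bl n ω + 1 ∧ Re (n+1) ω = Re n ω) ∨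
                (Bl (n+1) ω = Bl n ω ∧ Re (n+1) ω = Re n ω + 1)
  markov : ∀ n : ℕ,
    μ[(fun ω => if Bl (n+1) ω = Bl n ω + 1 then (1:ℝ) else 0) |
        ⨆ j ∈ Set.Iic n, MeasurableSpace.comap (fun ω => (Bl j ω, Re j ω)) inferInstance]
      =ᵐ[μ] fun ω => b (Bl n ω) / (b (Bl n ω) + r (Re n ω))

namespace Urn

variable {Ω : Type*} [MeasurableSpace Ω] {μ : Measure Ω} {b r : ℕ → ℝ}

/-- The discrepancy `𝔇_n = ℜ_n − 𝔅_n`. -/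
def D (U : Urn μ b r) (n : ℕ) (ω : Ω) : ℤ := (U.Re n ω : ℤ) - (U.Bl n ω : ℤ)

/-- `τ_k^𝔅`, the number of draws until the `k`-th blue ball. -/
noncomputable def tau (U : Urn μ b r) : ℕ → Ω → ℕ
  | 0 => fun _ => 0
  | k+1 => fun ω => sInf {n : ℕ | U.tau k ω < n ∧ U.Bl n ω = U.Bl (n-1) ω + 1}

/-- The natural filtration `ℱ_n = σ((𝔅_j, ℜ_j), j ≤ n)`. -/
def F (U : Urn μ b r) (n : ℕ) : MeasurableSpace Ω :=
  ⨆ j ∈ Set.Iic n, MeasurableSpace.comap (fun ω => (U.Bl j ω, U.Re j ω)) inferInstance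

end Urn

section PowerEstimates

theorem rpow_sub_one_le_of_mem_scale (α : ℝ) {k z : ℝ} (hk : 0 < k) (h1 : k / 2 ≤ z)
    (h2 : z ≤ 16 * k) :
    z ^ (α - 1) ≤ ((1 / 2 : ℝ) ^ (α - 1) + 16 ^ (α - 1)) * k ^ (α - 1) := by
  have hk' : 0 ≤ k ^ (α - 1) := by positivity
  have hA : 0 ≤ (1 / 2 : ℝ) ^ (α - 1) := by positivity
  have hB : 0 ≤ (16 : ℝ) ^ (α - 1) := by positivity
  rcases le_total 0 (α - 1) with h | h
  · calc z ^ (α - 1) ≤ (16 * k) ^ (α - 1) := Real.rpow_le_rpow (by linarith) h2 h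
      _ = 16 ^ (α - 1) * k ^ (α - 1) := Real.mul_rpow (by norm_num) hk.le
      _ ≤ _ := by nlinarith
  · calc z ^ (α - 1) ≤ (1 / 2 * k) ^ (α - 1) :=
          Real.rpow_le_rpow_of_nonpos (by linarith) (by linarith) h
      _ = (1 / 2) ^ (α - 1) * k ^ (α - 1) := Real.mul_rpow (by norm_num) hk.le
      _ ≤ _ := by nlinarith

theorem abs_rpow_sub_rpow_le_of_mem_scale {α : ℝ} (hα : 0 < α) {k x y : ℝ} (hk : 0 < k)
    (hx1 : k / 2 ≤ x) (hx2 : x ≤ 16 * k) (hy1 : k / 2 ≤ y) (hy2 : y ≤ 16 * k) :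
    |x ^ α - y ^ α| ≤
      α * ((1 / 2 : ℝ) ^ (α - 1) + 16 ^ (α - 1)) * k ^ (α - 1) * |x - y| := by
  have key := Convex.norm_image_sub_le_of_norm_hasDerivWithin_le
    (f := fun z : ℝ => z ^ α) (f' := fun z => α * z ^ (α - 1)) (s := Set.Icc (k / 2) (16 * k))
    (C := α * ((1 / 2 : ℝ) ^ (α - 1) + 16 ^ (α - 1)) * k ^ (α - 1)) (x := y) (y := x)
    (fun z hz => (Real.hasDerivAt_rpow_const (Or.inl (by linarith [hz.1]))).hasDerivWithinAt)
    (fun z hz => by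
      have hz0 : 0 < z := by linarith [hz.1]
      have := rpow_sub_one_le_of_mem_scale α hk hz.1 hz.2
      rw [Real.norm_of_nonneg (by positivity), mul_assoc]
      exact mul_le_mul_of_nonneg_left this hα.le)
    (convex_Icc _ _) ⟨hy1, hy2⟩ ⟨hx1, hx2⟩
  simpa [Real.norm_eq_abs] using key

theorem exists_forall_le_mul_of_eventually {f g : ℕ → ℝ} (hg : ∀ l, 0 < g l) {C : ℝ}
    (N : ℕ) (h : ∀ l, N ≤ l → f l ≤ C * g l) :
    ∃ C' > 0, ∀ l, f l ≤ C' * g l := by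
  refine ⟨|C| + ∑ m ∈ Finset.range N, |f m| / g m + 1, ?_, fun l => ?_⟩
  · have : 0 ≤ ∑ m ∈ Finset.range N, |f m| / g m :=
      Finset.sum_nonneg fun m _ => div_nonneg (abs_nonneg _) (hg m).le
    positivity
  · have hs : ∀ m ∈ Finset.range N, 0 ≤ |f m| / g m :=
      fun m _ => div_nonneg (abs_nonneg _) (hg m).le
    have hC := abs_nonneg C
    rcases le_or_gt N l with hl | hl
    · refine (h l hl).trans (mul_le_mul_of_nonneg_right ?_ (hg l).le)
      linarith [le_abs_self C, Finset.sum_nonneg hs]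
    · have h1 := Finset.single_le_sum hs (Finset.mem_range.2 hl)
      calc f l ≤ |f l| / g l * g l := by
            rw [div_mul_cancel₀ _ (hg l).ne']; exact le_abs_self _
        _ ≤ _ := mul_le_mul_of_nonneg_right (by linarith) (hg l).le

theorem sum_rpow_sub_one_le {α : ℝ} (hα : 0 < α) (k : ℕ) :
    ∑ l ∈ Finset.range k, ((l : ℝ) + 1) ^ (α - 1) ≤ (1 + 1 / α) * (k : ℝ) ^ α := by
  have hinv : 0 < 1 / α := by positivity
  rcases le_total 1 α with h | h
  · rcases Nat.eq_zero_or_pos k with rfl | hk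
    · simp [Real.zero_rpow hα.ne']
    have hk' : (0 : ℝ) < k := by exact_mod_cast hk
    calc ∑ l ∈ Finset.range k, ((l : ℝ) + 1) ^ (α - 1)
        ≤ ∑ l ∈ Finset.range k, (k : ℝ) ^ (α - 1) := by
          refine Finset.sum_le_sum fun l hl => Real.rpow_le_rpow (by positivity) ?_ (by linarith)
          exact_mod_cast Finset.mem_range.1 hl
      _ = (k : ℝ) ^ α := by
          rw [Finset.sum_const, Finset.card_range, nsmul_eq_mul, Real.rpow_sub_one hk'.ne']
          field_simp
      _ ≤ _ := by nlinarith [Real.rpow_pos_of_pos hk' α]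
  · suffices hs : ∑ l ∈ Finset.range k, ((l : ℝ) + 1) ^ (α - 1) ≤ (1 / α) * (k : ℝ) ^ α by
      have : (0 : ℝ) ≤ (k : ℝ) ^ α := by positivity
      nlinarith
    induction k with
    | zero => simp [Real.zero_rpow hα.ne']
    | succ k ih =>
      rw [Finset.sum_range_succ]
      have hx : (0 : ℝ) < k + 1 := by positivity
      have hb := rpow_one_add_le_one_add_mul_self (s := -1 / ((k : ℝ) + 1)) (p := α)
        (by rw [le_div_iff₀ hx]; linarith [(Nat.cast_nonneg k : (0 : ℝ) ≤ k)]) hα.le h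
      have he : 1 + -1 / ((k : ℝ) + 1) = k / (k + 1) := by field_simp; ring
      rw [he, Real.div_rpow (by positivity) hx.le, div_le_iff₀ (by positivity)] at hb
      have h1 : ((k : ℝ) + 1) ^ (α - 1) = ((k : ℝ) + 1) ^ α / (k + 1) :=
        Real.rpow_sub_one hx.ne' α
      have h2 : (1 + α * (-1 / ((k : ℝ) + 1))) * ((k : ℝ) + 1) ^ α
          = ((k : ℝ) + 1) ^ α - α * ((k : ℝ) + 1) ^ (α - 1) := by
        rw [h1]; field_simp; ring
      rw [h2] at hb
      push_cast
      have h3 : ((k : ℝ) + 1) ^ (α - 1)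
          ≤ 1 / α * (((k : ℝ) + 1) ^ α - (k : ℝ) ^ α) := by
        rw [one_div, inv_mul_eq_div, le_div_iff₀ hα]; linarith
      linarith

end PowerEstimates

/-- `u l = a (l+1)^α (1 + O(1/l))`, with explicit constant. -/
def PowerAsymp (u : ℕ → ℝ) (α a C : ℝ) : Prop :=
  ∀ l : ℕ, |u l - a * ((l : ℝ) + 1) ^ α| ≤ C * ((l : ℝ) + 1) ^ (α - 1)

theorem PowerAsymp.mono {u : ℕ → ℝ} {α a C C' : ℝ} (h : PowerAsymp u α a C) (hC : C ≤ C') :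
    PowerAsymp u α a C' :=
  fun l => (h l).trans (mul_le_mul_of_nonneg_right hC (by positivity))

theorem WeightAsymp.exists_powerAsymp {w : ℕ → ℝ} {α B : ℝ} (hα : 0 < α)
    (h : WeightAsymp w α B) {δ : ℕ} (hδ : δ ≤ 1) :
    ∃ C > 0, PowerAsymp (fun l => 1 / w (2 * l + δ)) α (2 ^ α) C := by
  obtain ⟨C₀, hC₀, N₀, hN⟩ := h
  set L : ℝ := (1 / 2 : ℝ) ^ (α - 1) + 16 ^ (α - 1) with hL
  have hL0 : 0 < L := by positivity
  refine exists_forall_le_mul_of_eventually (fun l => by positivity)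
    (C := (C₀ + 2 * |B|) * L + α * L * 2) (N₀ + 1) fun l hl => ?_
  have hl1 : (1 : ℝ) ≤ l := by exact_mod_cast (by omega : 1 ≤ l)
  have hδ' : (δ : ℝ) ≤ 1 := by exact_mod_cast hδ
  have hδ0 : (0 : ℝ) ≤ δ := by positivity
  have hk : (0 : ℝ) < (l : ℝ) + 1 := by positivity
  have hm := hN (2 * l + δ) (by omega)
  push_cast at hm
  set m : ℝ := 2 * l + δ with hm_def
  have hm1 : 1 ≤ m := by linarith
  have hpow : m ^ (α - 2) ≤ m ^ (α - 1) := Real.rpow_le_rpow_of_exponent_le hm1 (by linarith)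
  have hsc := rpow_sub_one_le_of_mem_scale α hk (z := m) (by linarith) (by linarith)
  have hmv := abs_rpow_sub_rpow_le_of_mem_scale hα hk (x := m) (y := 2 * (l + 1))
    (by linarith) (by linarith) (by linarith) (by linarith)
  rw [Real.mul_rpow (by norm_num) hk.le] at hmv
  have hd : |m - 2 * ((l : ℝ) + 1)| ≤ 2 := by
    rw [abs_le]; constructor <;> linarith
  rw [← hL] at hsc hmv
  have hp0 : 0 < m ^ (α - 1) := by positivity
  have h1 : |1 / w (2 * l + δ) - m ^ α| ≤ (C₀ + 2 * |B|) * m ^ (α - 1) := by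
    calc |1 / w (2 * l + δ) - m ^ α|
        = |(1 / w (2 * l + δ) - m ^ α - 2 * B * m ^ (α - 1)) + 2 * B * m ^ (α - 1)| := by
          congr 1; ring
      _ ≤ _ := abs_add_le _ _
      _ ≤ C₀ * m ^ (α - 2) + 2 * |B| * m ^ (α - 1) := by
          refine add_le_add hm (le_of_eq ?_)
          rw [abs_mul, abs_mul, abs_of_pos hp0]; norm_num
      _ ≤ _ := by nlinarith
  calc |1 / w (2 * l + δ) - 2 ^ α * ((l : ℝ) + 1) ^ α|
      ≤ |1 / w (2 * l + δ) - m ^ α| + |m ^ α - 2 ^ α * ((l : ℝ) + 1) ^ α| := abs_sub_le _ _ _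
    _ ≤ (C₀ + 2 * |B|) * (L * ((l : ℝ) + 1) ^ (α - 1))
        + α * L * ((l : ℝ) + 1) ^ (α - 1) * 2 := by
        refine add_le_add (h1.trans ?_) (hmv.trans ?_)
        · exact mul_le_mul_of_nonneg_left hsc (by positivity)
        · exact mul_le_mul_of_nonneg_left hd (by positivity)
    _ = _ := by ring

/-- Regularity of two positive sequences `u`, `v` at every scale `k`, where `κ k` is their
common order of magnitude at indices comparable to `k`. -/
structure ScaleRegular (u v κ : ℕ → ℝ) (c C : ℝ) : Prop where
  scale_pos : ∀ k, 1 ≤ k → 0 < κ k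
  left_le : ∀ k l, 1 ≤ k → l ≤ 8 * k → u l ≤ C * κ k
  right_le : ∀ k l, 1 ≤ k → l ≤ 8 * k → v l ≤ C * κ k
  le_left : ∀ k l, 1 ≤ k → k ≤ 2 * (l + 1) → c * κ k ≤ u l
  le_right : ∀ k l, 1 ≤ k → k ≤ 2 * (l + 1) → c * κ k ≤ v l
  osc : ∀ k l l', 1 ≤ k → k ≤ 2 * (l + 1) → k ≤ 2 * (l' + 1) → l ≤ 8 * k → l' ≤ 8 * k →
    |u l - v l'| ≤ C * (|(l : ℝ) - l'| + 1) / k * κ k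
  sum_sub : ∀ k, 1 ≤ k →
    |∑ l ∈ Finset.range k, u l - ∑ l ∈ Finset.range k, v l| ≤ C * κ k

theorem PowerAsymp.exists_le_mul {u : ℕ → ℝ} {α a C : ℝ} (hα : 0 < α) (ha : 0 < a)
    (hu : ∀ l, 0 < u l) (h : PowerAsymp u α a C) :
    ∃ c > 0, ∀ k l : ℕ, 1 ≤ k → k ≤ 2 * (l + 1) → c * (k : ℝ) ^ α ≤ u l := by
  obtain ⟨c', hc', hle⟩ := exists_forall_le_mul_of_eventually (f := fun l : ℕ => ((l : ℝ) + 1) ^ α)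
    (g := u) (C := 2 / a) hu (Nat.ceil (2 * C / a)) (fun l hl => by
      have hl' := (Nat.le_ceil (2 * C / a)).trans (Nat.cast_le.2 hl)
      rw [div_le_iff₀ ha] at hl'
      have hx : (0 : ℝ) < (l : ℝ) + 1 := by positivity
      have h1 := (abs_le.1 (h l)).1
      rw [Real.rpow_sub_one hx.ne'] at h1
      have h2 : C * (((l : ℝ) + 1) ^ α / (l + 1)) ≤ a / 2 * ((l : ℝ) + 1) ^ α := by
        rw [← mul_div_assoc, div_le_iff₀ hx]
        have : 0 < ((l : ℝ) + 1) ^ α := by positivity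
        nlinarith
      rw [div_mul_eq_mul_div, le_div_iff₀ ha]
      linarith)
  refine ⟨1 / (c' * 2 ^ α), by positivity, fun k l _ hkl => ?_⟩
  have h1 : (k : ℝ) ^ α ≤ 2 ^ α * ((l : ℝ) + 1) ^ α := by
    rw [← Real.mul_rpow (by norm_num) (by positivity)]
    exact Real.rpow_le_rpow (by positivity) (by exact_mod_cast hkl) hα.le
  rw [div_mul_eq_mul_div, one_mul, div_le_iff₀ (by positivity)]
  have h2 := hle l
  have h3 : (0 : ℝ) < 2 ^ α := by positivity
  nlinarith

theorem PowerAsymp.le_mul {u : ℕ → ℝ} {α a C : ℝ} (hα : 0 < α) (ha : 0 < a) (hC : 0 < C)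
    (h : PowerAsymp u α a C) {k l : ℕ} (hk : 1 ≤ k) (hl : l ≤ 8 * k) :
    u l ≤ (a + C) * 9 ^ α * (k : ℝ) ^ α := by
  have h1 := (abs_le.1 (h l)).2
  have h2 : ((l : ℝ) + 1) ^ (α - 1) ≤ ((l : ℝ) + 1) ^ α :=
    Real.rpow_le_rpow_of_exponent_le (by linarith [(Nat.cast_nonneg l : (0 : ℝ) ≤ l)])
      (by linarith)
  have h3 : ((l : ℝ) + 1) ^ α ≤ 9 ^ α * (k : ℝ) ^ α := by
    rw [← Real.mul_rpow (by norm_num) (by positivity)]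
    exact Real.rpow_le_rpow (by positivity) (by exact_mod_cast (by omega : l + 1 ≤ 9 * k)) hα.le
  nlinarith

theorem exists_scaleRegular {u v : ℕ → ℝ} {α a C : ℝ} (hα : 0 < α) (ha : 0 < a) (hC : 0 < C)
    (hu : ∀ l, 0 < u l) (hv : ∀ l, 0 < v l) (hua : PowerAsymp u α a C)
    (hva : PowerAsymp v α a C) :
    ∃ c > 0, ∃ C' > 0, ScaleRegular u v (fun k => (k : ℝ) ^ α) c C' := by
  obtain ⟨c₁, hc₁, h₁⟩ := hua.exists_le_mul hα ha hu
  obtain ⟨c₂, hc₂, h₂⟩ := hva.exists_le_mul hα ha hv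
  set L : ℝ := (1 / 2 : ℝ) ^ (α - 1) + 16 ^ (α - 1) with hL
  have hL0 : 0 < L := by positivity
  set K₁ := (a + C) * 9 ^ α
  set K₂ := 2 * C * L + a * (α * L)
  set K₃ := 2 * C * (1 + 1 / α)
  have hK₁ : 0 < K₁ := by positivity
  have hK₂ : 0 < K₂ := by positivity
  have hK₃ : 0 < K₃ := by positivity
  have hpos : ∀ k : ℕ, 1 ≤ k → (0 : ℝ) < (k : ℝ) ^ α := fun k hk =>
    Real.rpow_pos_of_pos (by exact_mod_cast hk) α
  refine ⟨min c₁ c₂, lt_min hc₁ hc₂, K₁ + K₂ + K₃, by positivity, hpos, ?_, ?_, ?_, ?_, ?_, ?_⟩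
  · intro k l hk hl
    refine (hua.le_mul hα ha hC hk hl).trans ?_
    exact mul_le_mul_of_nonneg_right (by linarith) (hpos k hk).le
  · intro k l hk hl
    refine (hva.le_mul hα ha hC hk hl).trans ?_
    exact mul_le_mul_of_nonneg_right (by linarith) (hpos k hk).le
  · intro k l hk hl
    exact (mul_le_mul_of_nonneg_right (min_le_left _ _) (hpos k hk).le).trans (h₁ k l hk hl)
  · intro k l hk hl
    exact (mul_le_mul_of_nonneg_right (min_le_right _ _) (hpos k hk).le).trans (h₂ k l hk hl)
  · intro k l l' hk hl hl' hl8 hl8'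
    have hk1 : (1 : ℝ) ≤ k := by exact_mod_cast hk
    have hk0 : (0 : ℝ) < k := by linarith
    have e1 : (k : ℝ) ≤ 2 * (l + 1) := by exact_mod_cast hl
    have e2 : (k : ℝ) ≤ 2 * (l' + 1) := by exact_mod_cast hl'
    have e3 : (l : ℝ) ≤ 8 * k := by exact_mod_cast hl8
    have e4 : (l' : ℝ) ≤ 8 * k := by exact_mod_cast hl8'
    have hs := rpow_sub_one_le_of_mem_scale α hk0 (z := l + 1) (by linarith) (by linarith)
    have hs' := rpow_sub_one_le_of_mem_scale α hk0 (z := l' + 1) (by linarith) (by linarith)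
    have hmv := abs_rpow_sub_rpow_le_of_mem_scale hα hk0 (x := l + 1) (y := l' + 1)
      (by linarith) (by linarith) (by linarith) (by linarith)
    rw [← hL] at hs hs' hmv
    rw [add_sub_add_right_eq_sub] at hmv
    have hp := hpos k hk
    have heq : (k : ℝ) ^ (α - 1) = (k : ℝ) ^ α / k := Real.rpow_sub_one hk0.ne' α
    have hp1 : 0 < (k : ℝ) ^ (α - 1) := by positivity
    have hd := abs_nonneg ((l : ℝ) - l')
    have a1 := abs_le.1 (hua l)
    have a2 := abs_le.1 (hva l')
    have a3 := abs_le.1 hmv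
    have b1 : C * ((l : ℝ) + 1) ^ (α - 1) ≤ C * (L * (k : ℝ) ^ (α - 1)) :=
      mul_le_mul_of_nonneg_left hs hC.le
    have b2 : C * ((l' : ℝ) + 1) ^ (α - 1) ≤ C * (L * (k : ℝ) ^ (α - 1)) :=
      mul_le_mul_of_nonneg_left hs' hC.le
    have b3 : a * |((l : ℝ) + 1) ^ α - ((l' : ℝ) + 1) ^ α| ≤
        a * (α * L * (k : ℝ) ^ (α - 1) * |(l : ℝ) - l'|) := mul_le_mul_of_nonneg_left hmv ha.le
    have b4 : |a * (((l : ℝ) + 1) ^ α - ((l' : ℝ) + 1) ^ α)| ≤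
        a * (α * L * (k : ℝ) ^ (α - 1) * |(l : ℝ) - l'|) := by
      rw [abs_mul, abs_of_pos ha]; exact b3
    have b5 := abs_le.1 b4
    have main : |u l - v l'| ≤ (2 * C * L + a * (α * L) * |(l : ℝ) - l'|) * (k : ℝ) ^ (α - 1) := by
      refine abs_le.2 ⟨?_, ?_⟩ <;> linarith
    refine main.trans ?_
    have : (K₁ + K₂ + K₃) * (|(l : ℝ) - l'| + 1) / k * (k : ℝ) ^ α
        = (K₁ + K₂ + K₃) * (|(l : ℝ) - l'| + 1) * (k : ℝ) ^ (α - 1) := by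
      rw [heq]; ring
    rw [this]
    refine mul_le_mul_of_nonneg_right ?_ hp1.le
    have q1 : 0 < 2 * C * L := by positivity
    have q2 : 0 < a * (α * L) := by positivity
    have q3 : K₂ = 2 * C * L + a * (α * L) := rfl
    nlinarith [mul_nonneg hK₁.le hd, mul_nonneg hK₃.le hd, mul_nonneg q1.le hd]
  · intro k hk
    rw [← Finset.sum_sub_distrib]
    calc |∑ l ∈ Finset.range k, (u l - v l)| ≤ ∑ l ∈ Finset.range k, |u l - v l| :=
          Finset.abs_sum_le_sum_abs _ _
      _ ≤ ∑ l ∈ Finset.range k, 2 * C * ((l : ℝ) + 1) ^ (α - 1) := by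
          refine Finset.sum_le_sum fun l _ => ?_
          have a1 := abs_le.1 (hua l)
          have a2 := abs_le.1 (hva l)
          rw [abs_le]; constructor <;> linarith
      _ ≤ 2 * C * ((1 + 1 / α) * (k : ℝ) ^ α) := by
          rw [← Finset.mul_sum]
          exact mul_le_mul_of_nonneg_left (sum_rpow_sub_one_le hα k) (by positivity)
      _ = K₃ * (k : ℝ) ^ α := by ring
      _ ≤ _ := mul_le_mul_of_nonneg_right (by linarith) (hpos k hk).le

theorem UrnChoice.exists_scaleRegular {w b r : ℕ → ℝ} {α B : ℝ} (hα : 0 < α)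
    (hasymp : WeightAsymp w α B) (hb : ∀ i, 0 < b i) (hr : ∀ i, 0 < r i)
    (h : UrnChoice w b r) :
    ∃ κ : ℕ → ℝ, ∃ c > 0, ∃ C > 0,
      ScaleRegular (fun l => 1 / b l) (fun l => 1 / r l) κ c C := by
  obtain ⟨C₁, hC₁, h₁⟩ := hasymp.exists_powerAsymp hα (δ := 0) (by norm_num)
  obtain ⟨C₂, hC₂, h₂⟩ := hasymp.exists_powerAsymp hα (δ := 1) le_rfl
  have h₁' := h₁.mono (le_max_left C₁ C₂)
  have h₂' := h₂.mono (le_max_right C₁ C₂)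
  have hP : PowerAsymp (fun l => 1 / b l) α (2 ^ α) (max C₁ C₂) ∧
      PowerAsymp (fun l => 1 / r l) α (2 ^ α) (max C₁ C₂) := by
    rcases h with h | h | h
    all_goals
      simp only [fun i => (h i).1, fun i => (h i).2]
      first
        | exact ⟨h₁', h₂'⟩
        | exact ⟨h₂', h₁'⟩
        | exact ⟨h₁', h₁'⟩
  obtain ⟨c, hc, C, hC, hreg⟩ := _root_.exists_scaleRegular hα (by positivity)
    (lt_max_of_lt_left hC₁) (fun l => one_div_pos.2 (hb l)) (fun l => one_div_pos.2 (hr l))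
    hP.1 hP.2
  exact ⟨_, c, hc, C, hC, hreg⟩

theorem Real.exp_le_add_exp_sq (x : ℝ) : Real.exp x ≤ x + Real.exp (x ^ 2) := by
  have h2 := Real.add_one_le_exp (x ^ 2)
  rcases le_or_gt |x| 1 with h | h
  · linarith [(abs_le.1 (Real.abs_exp_sub_one_sub_id_le h)).2]
  · rcases lt_abs.1 h with h | h
    · have : Real.exp x ≤ Real.exp (x ^ 2) := Real.exp_le_exp.2 (by nlinarith)
      linarith
    · have : Real.exp x ≤ 1 := Real.exp_le_one_iff.2 (by linarith)
      nlinarith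

theorem two_point_exp_le {p q x y z : ℝ} (hp : 0 ≤ p) (hq : 0 ≤ q) (hpq : p + q = 1)
    (hmean : p * x + q * y = 0) (hx : x ^ 2 ≤ z) (hy : y ^ 2 ≤ z) :
    p * Real.exp x + q * Real.exp y ≤ Real.exp z := by
  have h1 := (Real.exp_le_add_exp_sq x).trans (add_le_add_right (Real.exp_le_exp.2 hx) x)
  have h2 := (Real.exp_le_add_exp_sq y).trans (add_le_add_right (Real.exp_le_exp.2 hy) y)
  calc p * Real.exp x + q * Real.exp y ≤ p * (x + Real.exp z) + q * (y + Real.exp z) :=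
        add_le_add (mul_le_mul_of_nonneg_left h1 hp) (mul_le_mul_of_nonneg_left h2 hq)
    _ = (p * x + q * y) + (p + q) * Real.exp z := by ring
    _ = Real.exp z := by rw [hmean, hpq]; ring

namespace Urn

variable {Ω : Type*} [MeasurableSpace Ω] {μ : Measure Ω} {b r : ℕ → ℝ}

theorem comap_le_F (U : Urn μ b r) {j n : ℕ} (hj : j ≤ n) :
    MeasurableSpace.comap (fun ω => (U.Bl j ω, U.Re j ω)) inferInstance ≤ U.F n :=
  le_iSup₂_of_le (f := fun j (_ : j ∈ Set.Iic n) =>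
    MeasurableSpace.comap (fun ω => (U.Bl j ω, U.Re j ω)) inferInstance) j hj le_rfl

theorem F_mono (U : Urn μ b r) {m n : ℕ} (h : m ≤ n) : U.F m ≤ U.F n :=
  iSup₂_le fun _ hj => U.comap_le_F (le_trans hj h)

theorem F_le (U : Urn μ b r) (n : ℕ) : U.F n ≤ ‹MeasurableSpace Ω› :=
  iSup₂_le fun j _ => ((U.meas_Bl j).prodMk (U.meas_Re j)).comap_le

theorem measurableSet_F_state (U : Urn μ b r) {j n : ℕ} (hj : j ≤ n) (P : ℕ × ℕ → Prop) :
    MeasurableSet[U.F n] {ω | P (U.Bl j ω, U.Re j ω)} :=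
  U.comap_le_F hj _ ⟨{x | P x}, DiscreteMeasurableSpace.forall_measurableSet _, rfl⟩

theorem measureReal_inter_blue [IsProbabilityMeasure μ] (U : Urn μ b r) {t i j : ℕ} {A : Set Ω}
    (hA : MeasurableSet[U.F t] A) (hAs : ∀ ω ∈ A, U.Bl t ω = i ∧ U.Re t ω = j) :
    μ.real (A ∩ {ω | U.Bl (t + 1) ω = i + 1}) = b i / (b i + r j) * μ.real A := by
  have hA' : MeasurableSet A := U.F_le t _ hA
  have hE : MeasurableSet {ω | U.Bl (t + 1) ω = U.Bl t ω + 1} :=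
    measurableSet_eq_fun (U.meas_Bl (t + 1)) ((U.meas_Bl t).add_const 1)
  have hind : (fun ω => if U.Bl (t + 1) ω = U.Bl t ω + 1 then (1 : ℝ) else 0)
      = {ω | U.Bl (t + 1) ω = U.Bl t ω + 1}.indicator 1 := by
    ext ω; simp [Set.indicator_apply]
  have hint : Integrable (fun ω => if U.Bl (t + 1) ω = U.Bl t ω + 1 then (1 : ℝ) else 0) μ := by
    rw [hind]; exact (integrable_const (1 : ℝ)).indicator hE
  have h := setIntegral_condExp (U.F_le t) hint hA
  have h2 := setIntegral_congr_ae (s := A) hA' ((U.markov t).mono fun ω hω _ => hω)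
  have h3 : ∫ ω in A, b (U.Bl t ω) / (b (U.Bl t ω) + r (U.Re t ω)) ∂μ
      = ∫ _ in A, b i / (b i + r j) ∂μ :=
    setIntegral_congr_fun hA' fun ω hω => by
      simp only [(hAs ω hω).1, (hAs ω hω).2]
  have h4 : A ∩ {ω | U.Bl (t + 1) ω = i + 1} = A ∩ {ω | U.Bl (t + 1) ω = U.Bl t ω + 1} := by
    ext ω
    simp only [Set.mem_inter_iff, Set.mem_ofPred_eq, and_congr_right_iff]
    intro hω; rw [(hAs ω hω).1]
  rw [h4]
  have h5 : ∫ ω in A, (if U.Bl (t + 1) ω = U.Bl t ω + 1 then (1 : ℝ) else 0) ∂μ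
      = μ.real (A ∩ {ω | U.Bl (t + 1) ω = U.Bl t ω + 1}) := by
    rw [hind, setIntegral_indicator hE]; simp
  rw [← h5, ← h]
  refine h2.trans (h3.trans ?_)
  simp [mul_comm]

/-- The martingale `∑_{i < 𝔅_n} 1/b(i) − ∑_{j < ℜ_n} 1/r(j)`. -/
noncomputable def S (U : Urn μ b r) (n : ℕ) (ω : Ω) : ℝ :=
  ∑ l ∈ Finset.range (U.Bl n ω), 1 / b l - ∑ l ∈ Finset.range (U.Re n ω), 1 / r l

/-- Maximal exponential inequality for `S` started from a fixed state. -/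
theorem measureReal_inter_exists_le_mul_S [IsProbabilityMeasure μ] (U : Urn μ b r)
    (hb : ∀ i, 0 < b i) (hr : ∀ i, 0 < r i) {K : ℝ} {Q : ℕ}
    (hbK : ∀ l ≤ Q, 1 / b l ≤ K) (hrK : ∀ l ≤ Q, 1 / r l ≤ K) (θ a : ℝ) (N : ℕ) :
    ∀ (t i j : ℕ) (A : Set Ω), MeasurableSet[U.F t] A →
      (∀ ω ∈ A, U.Bl t ω = i ∧ U.Re t ω = j) → i + j + N ≤ Q →
      μ.real (A ∩ {ω | ∃ l, t ≤ l ∧ l ≤ t + N ∧ a ≤ θ * U.S l ω}) ≤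
        μ.real A * Real.exp (θ * (∑ l ∈ Finset.range i, 1 / b l - ∑ l ∈ Finset.range j, 1 / r l)
          - a + N * (θ * K) ^ 2) := by
  induction N with
  | zero =>
    intro t i j A hA hAs _
    rcases le_or_gt a (θ * (∑ l ∈ Finset.range i, 1 / b l - ∑ l ∈ Finset.range j, 1 / r l))
      with h | h
    · refine (measureReal_mono Set.inter_subset_left).trans
        (le_mul_of_one_le_right measureReal_nonneg (Real.one_le_exp ?_))
      push_cast; linarith
    · have : A ∩ {ω | ∃ l, t ≤ l ∧ l ≤ t + 0 ∧ a ≤ θ * U.S l ω} = ∅ := by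
        ext ω
        simp only [Set.mem_inter_iff, Set.mem_ofPred_eq, Set.mem_empty_iff_false, iff_false, not_and]
        rintro hω ⟨l, h1, h2, h3⟩
        obtain rfl : l = t := by omega
        rw [S, (hAs ω hω).1, (hAs ω hω).2] at h3
        linarith
      rw [this]
      simp only [measureReal_empty]
      positivity
  | succ N ih =>
    intro t i j A hA hAs hQ
    set s := ∑ l ∈ Finset.range i, 1 / b l - ∑ l ∈ Finset.range j, 1 / r l with hs
    rcases le_or_gt a (θ * s) with h | h
    · refine (measureReal_mono Set.inter_subset_left).trans
        (le_mul_of_one_le_right measureReal_nonneg (Real.one_le_exp ?_))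
      have : 0 ≤ ((N + 1 : ℕ) : ℝ) * (θ * K) ^ 2 := by positivity
      linarith
    set A₁ := A ∩ {ω | U.Bl (t + 1) ω = i + 1} with hA₁
    set A₂ := A \ {ω | U.Bl (t + 1) ω = i + 1} with hA₂
    have hAF : MeasurableSet[U.F (t + 1)] A := U.F_mono (Nat.le_succ t) _ hA
    have hEF : MeasurableSet[U.F (t + 1)] {ω | U.Bl (t + 1) ω = i + 1} :=
      U.measurableSet_F_state le_rfl fun x => x.1 = i + 1
    have hm₁ : μ.real A₁ = b i / (b i + r j) * μ.real A := U.measureReal_inter_blue hA hAs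
    have hm₂ : μ.real A₂ = r j / (b i + r j) * μ.real A := by
      have := measureReal_inter_add_sdiff (μ := μ) (s := A) (U.F_le _ _ hEF)
      rw [← hA₁, ← hA₂, hm₁] at this
      have hne : b i + r j ≠ 0 := (add_pos (hb i) (hr j)).ne'
      rw [eq_sub_of_add_eq' this]
      field_simp
      ring
    have ih₁ := ih (t + 1) (i + 1) j A₁
      (@MeasurableSet.inter _ (U.F (t + 1)) _ _ hAF hEF) (fun ω hω => by
        have h1 := hAs ω hω.1
        have h2 : U.Bl (t + 1) ω = i + 1 := hω.2
        have h3 := U.step t ω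
        omega) (by omega)
    have ih₂ := ih (t + 1) i (j + 1) A₂
      (@MeasurableSet.diff _ (U.F (t + 1)) _ _ hAF hEF) (fun ω hω => by
        have h1 := hAs ω hω.1
        have h2 : ¬ U.Bl (t + 1) ω = i + 1 := hω.2
        have h3 := U.step t ω
        omega) (by omega)
    have hsub : A ∩ {ω | ∃ l, t ≤ l ∧ l ≤ t + (N + 1) ∧ a ≤ θ * U.S l ω} ⊆
        (A₁ ∩ {ω | ∃ l, t + 1 ≤ l ∧ l ≤ t + 1 + N ∧ a ≤ θ * U.S l ω}) ∪
        (A₂ ∩ {ω | ∃ l, t + 1 ≤ l ∧ l ≤ t + 1 + N ∧ a ≤ θ * U.S l ω}) := by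
      rintro ω ⟨hω, l, h1, h2, h3⟩
      have hl : t ≠ l := by
        rintro rfl
        rw [S, (hAs ω hω).1, (hAs ω hω).2] at h3
        linarith
      have hex : ∃ l, t + 1 ≤ l ∧ l ≤ t + 1 + N ∧ a ≤ θ * U.S l ω :=
        ⟨l, by omega, by omega, h3⟩
      by_cases hE : U.Bl (t + 1) ω = i + 1
      · exact Or.inl ⟨⟨hω, hE⟩, hex⟩
      · exact Or.inr ⟨⟨hω, hE⟩, hex⟩
    have hKi := hbK i (by omega)
    have hKj := hrK j (by omega)
    have hbi := hb i
    have hrj := hr j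
    have hstep : b i / (b i + r j) * Real.exp (θ * (1 / b i))
        + r j / (b i + r j) * Real.exp (-(θ * (1 / r j))) ≤ Real.exp ((θ * K) ^ 2) := by
      have hub : 0 < 1 / b i := by positivity
      have hur : 0 < 1 / r j := by positivity
      refine two_point_exp_le (by positivity) (by positivity) ?_ ?_ ?_ ?_
      · field_simp
      · field_simp; ring
      · rw [mul_pow, mul_pow]; gcongr
      · rw [neg_sq, mul_pow, mul_pow]; gcongr
    refine (measureReal_mono hsub).trans ((measureReal_union_le _ _).trans
      ((add_le_add ih₁ ih₂).trans ?_))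
    rw [hm₁, hm₂, Finset.sum_range_succ, Finset.sum_range_succ]
    have e1 : θ * (∑ l ∈ Finset.range i, 1 / b l + 1 / b i - ∑ l ∈ Finset.range j, 1 / r l)
        - a + N * (θ * K) ^ 2 = θ * (1 / b i) + (θ * s - a + N * (θ * K) ^ 2) := by
      rw [hs]; ring
    have e2 : θ * (∑ l ∈ Finset.range i, 1 / b l - (∑ l ∈ Finset.range j, 1 / r l + 1 / r j))
        - a + N * (θ * K) ^ 2 = -(θ * (1 / r j)) + (θ * s - a + N * (θ * K) ^ 2) := by
      rw [hs]; ring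
    have e3 : θ * s - a + ((N + 1 : ℕ) : ℝ) * (θ * K) ^ 2
        = (θ * K) ^ 2 + (θ * s - a + N * (θ * K) ^ 2) := by
      push_cast; ring
    rw [e1, e2, e3, Real.exp_add (θ * (1 / b i)), Real.exp_add (-(θ * (1 / r j))),
      Real.exp_add ((θ * K) ^ 2)]
    have hA0 : 0 ≤ μ.real A * Real.exp (θ * s - a + N * (θ * K) ^ 2) := by positivity
    calc _ = (μ.real A * Real.exp (θ * s - a + N * (θ * K) ^ 2)) *
          (b i / (b i + r j) * Real.exp (θ * (1 / b i))
            + r j / (b i + r j) * Real.exp (-(θ * (1 / r j)))) := by ring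
      _ ≤ (μ.real A * Real.exp (θ * s - a + N * (θ * K) ^ 2)) * Real.exp ((θ * K) ^ 2) :=
          mul_le_mul_of_nonneg_left hstep hA0
      _ = _ := by ring

/-- Two-sided maximal Azuma inequality for `S` started from a fixed state. -/
theorem measureReal_inter_exists_le_abs_S_sub [IsProbabilityMeasure μ] (U : Urn μ b r)
    (hb : ∀ i, 0 < b i) (hr : ∀ i, 0 < r i) {K : ℝ} (hK : 0 < K) {Q : ℕ}
    (hbK : ∀ l ≤ Q, 1 / b l ≤ K) (hrK : ∀ l ≤ Q, 1 / r l ≤ K) {s : ℝ} (hs : 0 ≤ s) {N : ℕ}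
    (hN : 1 ≤ N) {t i j : ℕ} {A : Set Ω} (hA : MeasurableSet[U.F t] A)
    (hAs : ∀ ω ∈ A, U.Bl t ω = i ∧ U.Re t ω = j) (hQ : i + j + N ≤ Q) :
    μ.real (A ∩ {ω | ∃ l, t ≤ l ∧ l ≤ t + N ∧ s ≤ |U.S l ω - U.S t ω|}) ≤
      μ.real A * (2 * Real.exp (-(s ^ 2 / (4 * N * K ^ 2)))) := by
  have hN' : (0 : ℝ) < N := by exact_mod_cast hN
  set s₀ := ∑ l ∈ Finset.range i, 1 / b l - ∑ l ∈ Finset.range j, 1 / r l with hs₀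
  set θ := s / (2 * N * K ^ 2) with hθ
  have hSt : ∀ ω ∈ A, U.S t ω = s₀ := fun ω hω => by
    rw [S, (hAs ω hω).1, (hAs ω hω).2]
  have hθs : θ * s = s ^ 2 / (2 * N * K ^ 2) := by rw [hθ]; ring
  have h₁ := U.measureReal_inter_exists_le_mul_S hb hr hbK hrK θ (θ * (s₀ + s)) N t i j A hA hAs hQ
  have h₂ := U.measureReal_inter_exists_le_mul_S hb hr hbK hrK (-θ) (-θ * (s₀ - s)) N t i j A
    hA hAs hQ
  have e1 : θ * s₀ - θ * (s₀ + s) + N * (θ * K) ^ 2 = -(s ^ 2 / (4 * N * K ^ 2)) := by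
    rw [hθ]; field_simp; ring
  have e2 : -θ * s₀ - -θ * (s₀ - s) + N * (-θ * K) ^ 2 = -(s ^ 2 / (4 * N * K ^ 2)) := by
    rw [hθ]; field_simp; ring
  rw [← hs₀, e1] at h₁
  rw [← hs₀, e2] at h₂
  have hθ0 : 0 ≤ θ := by positivity
  have hsub : A ∩ {ω | ∃ l, t ≤ l ∧ l ≤ t + N ∧ s ≤ |U.S l ω - U.S t ω|} ⊆
      (A ∩ {ω | ∃ l, t ≤ l ∧ l ≤ t + N ∧ θ * (s₀ + s) ≤ θ * U.S l ω}) ∪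
      (A ∩ {ω | ∃ l, t ≤ l ∧ l ≤ t + N ∧ -θ * (s₀ - s) ≤ -θ * U.S l ω}) := by
    rintro ω ⟨hω, l, h1, h2, h3⟩
    rw [hSt ω hω] at h3
    rcases le_abs.1 h3 with h3 | h3
    · exact Or.inl ⟨hω, l, h1, h2, mul_le_mul_of_nonneg_left (by linarith) hθ0⟩
    · refine Or.inr ⟨hω, l, h1, h2, ?_⟩
      rw [neg_mul, neg_mul, neg_le_neg_iff]
      exact mul_le_mul_of_nonneg_left (by linarith) hθ0
  refine (measureReal_mono hsub).trans ((measureReal_union_le _ _).trans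
    ((add_le_add h₁ h₂).trans (le_of_eq ?_)))
  ring

end Urn

section PartialSums

open Finset

theorem mul_sub_le_sum_range_sub {v : ℕ → ℝ} {d : ℝ} {p q : ℕ} (hpq : p ≤ q)
    (h : ∀ l, p ≤ l → d ≤ v l) :
    d * ((q : ℝ) - p) ≤ ∑ l ∈ range q, v l - ∑ l ∈ range p, v l := by
  rw [← sum_Ico_eq_sub v hpq]
  have := card_nsmul_le_sum (Ico p q) v d fun l hl => h l (mem_Ico.1 hl).1
  rw [Nat.card_Ico, nsmul_eq_mul, Nat.cast_sub hpq] at this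
  linarith

theorem mul_sub_mul_le_sum_range_sub_sum_range {u v : ℕ → ℝ} {d e : ℝ} {m q : ℕ} (hmq : m ≤ q)
    (hv : ∀ l, d ≤ v l) (huv : ∀ l, l < m → u l - v l ≤ e) :
    d * ((q : ℝ) - m) - m * e ≤ ∑ l ∈ range q, v l - ∑ l ∈ range m, u l := by
  have h1 := mul_sub_le_sum_range_sub hmq fun l _ => hv l
  have h2 : ∑ l ∈ range m, (u l - v l) ≤ m * e := by
    simpa using sum_le_card_nsmul (range m) _ e fun l hl => huv l (mem_range.1 hl)
  rw [sum_sub_distrib] at h2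
  linarith

namespace ScaleRegular

variable {u v κ : ℕ → ℝ} {c C : ℝ}

theorem le_sub_of_le_of_add_le (h : ScaleRegular u v κ c C) (hc : 0 < c) {k i j : ℕ} {z : ℝ}
    (hk : 1 ≤ k) (hu : ∀ l, 0 < u l) (hik : i ≤ k) (hj : (k : ℝ) + z ≤ j) (hz : 0 ≤ z)
    (hCz : 4 * C ≤ c * z) :
    c * z / 4 * κ k ≤ ∑ l ∈ range j, v l - ∑ l ∈ range i, u l := by
  have hκ := h.scale_pos k hk
  have hkj : k ≤ j := by
    have : (k : ℝ) ≤ j := by linarith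
    exact_mod_cast this
  have h1 := mul_sub_le_sum_range_sub (v := v) (d := c * κ k) hkj
    fun l hl => h.le_right k l hk (by omega)
  have h2 := mul_sub_le_sum_range_sub (v := u) (d := 0) hik fun l _ => (hu l).le
  have h3 := (abs_le.1 (h.sum_sub k hk)).2
  have h4 : c * κ k * z ≤ c * κ k * ((j : ℝ) - k) :=
    mul_le_mul_of_nonneg_left (by linarith) (by positivity)
  have h5 : 4 * C * κ k ≤ c * z * κ k := mul_le_mul_of_nonneg_right hCz hκ.le
  have h6 : 0 ≤ c * z * κ k := by positivity
  linarith

theorem le_sub_of_add_le (h : ScaleRegular u v κ c C) (hc : 0 < c) {k j : ℕ} {z : ℝ}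
    (hk : 1 ≤ k) (hv : ∀ l, 0 < v l) (hj : (j : ℝ) + z ≤ k) (hz : 0 ≤ z) (hCz : 4 * C ≤ c * z) :
    c * z / 4 * κ k ≤ ∑ l ∈ range k, u l - ∑ l ∈ range j, v l := by
  have hκ := h.scale_pos k hk
  have hjk : j ≤ k := by
    have : (j : ℝ) ≤ k := by linarith
    exact_mod_cast this
  have h1 := mul_sub_le_sum_range_sub (v := v) (d := c * κ k) (p := max j (k / 2)) (q := k)
    (by omega) fun l hl => h.le_right k l hk (by omega)
  have h2 := mul_sub_le_sum_range_sub (v := v) (d := 0) (le_max_left j (k / 2))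
    fun l _ => (hv l).le
  have h3 := (abs_le.1 (h.sum_sub k hk)).1
  have h4 : (z : ℝ) ≤ 2 * ((k : ℝ) - (max j (k / 2) : ℕ)) := by
    have : 2 * max j (k / 2) ≤ k + j := by omega
    have : 2 * ((max j (k / 2) : ℕ) : ℝ) ≤ k + j := by exact_mod_cast this
    linarith
  have h5 : c * κ k * z ≤ c * κ k * (2 * ((k : ℝ) - (max j (k / 2) : ℕ))) :=
    mul_le_mul_of_nonneg_left h4 (by positivity)
  have h6 : 4 * C * κ k ≤ c * z * κ k := mul_le_mul_of_nonneg_right hCz hκ.le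
  linarith

theorem abs_sub_lt_of_abs_increment_lt (h : ScaleRegular u v κ c C) (hc : 0 < c) (hC : 0 < C)
    {k j m q n : ℕ} {z x : ℝ} (hk : 1 ≤ k) (hnk : n ≤ k) (hmn : m ≤ n) (hmq : m + q ≤ 4 * n)
    (hz : 2 * z ≤ k) (hj : |(j : ℝ) - k| ≤ z) (hx : 0 ≤ x)
    (hnz : (n : ℝ) * (C * (z + 1) / k) ≤ c * x / 2)
    (hS : |(∑ l ∈ range (k + m), u l - ∑ l ∈ range (j + q), v l)
      - (∑ l ∈ range k, u l - ∑ l ∈ range j, v l)| < c * x / 2 * κ k) :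
    |(q : ℝ) - m| < x := by
  have hκ := h.scale_pos k hk
  have hk0 : (0 : ℝ) < k := by exact_mod_cast hk
  have hj' := abs_le.1 hj
  have hkj : k ≤ 2 * j := by
    have : (k : ℝ) ≤ 2 * j := by linarith
    exact_mod_cast this
  have hjk : 2 * j ≤ 3 * k := by
    have : 2 * (j : ℝ) ≤ 3 * k := by linarith
    exact_mod_cast this
  have hosc : ∀ l, l ≤ 4 * n → |u (k + l) - v (j + l)| ≤ C * (z + 1) / k * κ k := by
    intro l hl
    refine (h.osc k (k + l) (j + l) hk (by omega) (by omega) (by omega) (by omega)).trans ?_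
    have e : ((k + l : ℕ) : ℝ) - ((j + l : ℕ) : ℝ) = k - j := by push_cast; ring
    rw [e, abs_sub_comm]
    gcongr
  set e := C * (z + 1) / k * κ k with he
  have he0 : 0 ≤ e := (abs_nonneg _).trans (hosc 0 (Nat.zero_le _))
  have hne : (n : ℝ) * e ≤ c * x / 2 * κ k := by
    rw [he, ← mul_assoc]; exact mul_le_mul_of_nonneg_right hnz hκ.le
  rw [sum_range_add, sum_range_add] at hS
  have hS' := abs_lt.1 hS
  by_contra! hcon
  have hd : 0 < c * κ k := by positivity
  rcases le_abs.1 hcon with hle | hle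
  · have hmq' : m ≤ q := by
      have : (m : ℝ) ≤ q := by linarith
      exact_mod_cast this
    have key := mul_sub_mul_le_sum_range_sub_sum_range (u := fun l => u (k + l))
      (v := fun l => v (j + l)) (d := c * κ k) (e := e) hmq'
      (fun l => h.le_right k _ hk (by omega))
      (fun l hl => (abs_le.1 (hosc l (by omega))).2)
    have a1 : c * κ k * x ≤ c * κ k * ((q : ℝ) - m) := mul_le_mul_of_nonneg_left hle hd.le
    have a2 : (m : ℝ) * e ≤ n * e := mul_le_mul_of_nonneg_right (by exact_mod_cast hmn) he0
    linarith
  · have hqm : q ≤ m := by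
      have : (q : ℝ) ≤ m := by linarith
      exact_mod_cast this
    have key := mul_sub_mul_le_sum_range_sub_sum_range (u := fun l => v (j + l))
      (v := fun l => u (k + l)) (d := c * κ k) (e := e) hqm
      (fun l => h.le_left k _ hk (by omega))
      (fun l hl => by linarith [(abs_le.1 (hosc l (by omega))).1])
    have a1 : c * κ k * x ≤ c * κ k * ((m : ℝ) - q) :=
      mul_le_mul_of_nonneg_left (by linarith) hd.le
    have a2 : (q : ℝ) * e ≤ n * e :=
      mul_le_mul_of_nonneg_right (by exact_mod_cast hqm.trans hmn) he0
    linarith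

end ScaleRegular

end PartialSums

namespace Urn

variable {Ω : Type*} [MeasurableSpace Ω] {μ : Measure Ω} {b r : ℕ → ℝ}

theorem Bl_add_Re (U : Urn μ b r) (n : ℕ) (ω : Ω) : U.Bl n ω + U.Re n ω = n := by
  induction n with
  | zero => simp [U.init_Bl, U.init_Re]
  | succ n ih =>
    have := U.step n ω
    omega

theorem Bl_mono (U : Urn μ b r) (ω : Ω) : Monotone fun n => U.Bl n ω :=
  monotone_nat_of_le_succ fun n => by
    have := U.step n ω
    omega

theorem Re_mono (U : Urn μ b r) (ω : Ω) : Monotone fun n => U.Re n ω :=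
  monotone_nat_of_le_succ fun n => by
    have := U.step n ω
    omega

theorem S_zero (U : Urn μ b r) (ω : Ω) : U.S 0 ω = 0 := by
  simp [S, U.init_Bl, U.init_Re]

theorem tau_spec (U : Urn μ b r) {ω : Ω} {k N : ℕ} (h : k ≤ U.Bl N ω) :
    U.tau k ω ≤ N ∧ U.Bl (U.tau k ω) ω = k ∧ ∀ m, m < U.tau k ω → U.Bl m ω < k := by
  classical
  induction k with
  | zero => simp [tau, U.init_Bl]
  | succ k ih =>
    obtain ⟨-, hT, -⟩ := ih (by omega)
    set T := U.tau k ω with hTdef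
    have hex : ∃ n, k + 1 ≤ U.Bl n ω := ⟨N, h⟩
    set n₀ := Nat.find hex with hn₀
    have h1 : k + 1 ≤ U.Bl n₀ ω := Nat.find_spec hex
    have hmin : ∀ m, m < n₀ → U.Bl m ω < k + 1 := fun m hm => by
      have := Nat.find_min hex hm
      omega
    have hlt : T < n₀ := by
      by_contra! hcon
      have : U.Bl n₀ ω ≤ U.Bl T ω := U.Bl_mono ω hcon
      omega
    have hpred := hmin (n₀ - 1) (by omega)
    have hstep := U.step (n₀ - 1) ω
    rw [Nat.sub_add_cancel (by omega)] at hstep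
    have hmem : n₀ ∈ {n : ℕ | T < n ∧ U.Bl n ω = U.Bl (n - 1) ω + 1} := by
      refine ⟨hlt, ?_⟩
      omega
    have heq : U.tau (k + 1) ω = n₀ := by
      refine le_antisymm (Nat.sInf_le hmem) ?_
      obtain ⟨ht1, ht2⟩ := Nat.sInf_mem ⟨n₀, hmem⟩
      refine Nat.find_min' hex ?_
      have : U.Bl T ω ≤ U.Bl (sInf {n : ℕ | T < n ∧ U.Bl n ω = U.Bl (n - 1) ω + 1} - 1) ω :=
        U.Bl_mono ω (by omega)
      change k + 1 ≤ U.Bl (sInf {n : ℕ | T < n ∧ U.Bl n ω = U.Bl (n - 1) ω + 1}) ω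
      omega
    rw [heq]
    exact ⟨Nat.find_min' hex h, by omega, hmin⟩

/-- If `S` stays small up to time `4k` and has small oscillation after the `k`-th blue draw,
then the discrepancy oscillates little between the `k`-th and the `(k+n)`-th blue draw. -/
theorem abs_D_sub_lt (U : Urn μ b r) {κ : ℕ → ℝ} {c C : ℝ} (hb : ∀ i, 0 < b i)
    (hr : ∀ i, 0 < r i) (hc : 0 < c) (hC : 0 < C)
    (hreg : ScaleRegular (fun l => 1 / b l) (fun l => 1 / r l) κ c C) {k n : ℕ} (hk : 1 ≤ k)
    (hn : 1 ≤ n) (hnk : n ≤ k) {z x : ℝ} (hz : 0 ≤ z) (hzk : 2 * z ≤ k) (hCz : 4 * C ≤ c * z)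
    (hx : 0 ≤ x) (hxn : x ≤ n) (hnz : (n : ℝ) * (C * (z + 1) / k) ≤ c * x / 2) {ω : Ω}
    (h₁ : ∀ l, l ≤ 4 * k → |U.S l ω - U.S 0 ω| < c * z / 4 * κ k)
    (h₂ : ∀ t, t ≤ 4 * k → U.Bl t ω = k → U.Bl (t - 1) ω ≠ k →
      ∀ l, t ≤ l → l ≤ t + 4 * n → |U.S l ω - U.S t ω| < c * x / 2 * κ k)
    {i : ℕ} (hi₁ : U.tau k ω ≤ i) (hi₂ : i ≤ U.tau (k + n) ω) :
    |(U.D i ω : ℝ) - (U.D (U.tau k ω) ω : ℝ)| < x := by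
  have hu : ∀ l, 0 < 1 / b l := fun l => one_div_pos.2 (hb l)
  have hv : ∀ l, 0 < 1 / r l := fun l => one_div_pos.2 (hr l)
  simp only [U.S_zero, sub_zero] at h₁
  have hreach : k ≤ U.Bl (4 * k) ω := by
    by_contra! hlt
    have hsum := U.Bl_add_Re (4 * k) ω
    have hRe : (k : ℝ) + z ≤ U.Re (4 * k) ω := by
      have : 3 * k ≤ U.Re (4 * k) ω := by omega
      have : 3 * (k : ℝ) ≤ U.Re (4 * k) ω := by exact_mod_cast this
      linarith
    have key := hreg.le_sub_of_le_of_add_le hc hk hu hlt.le hRe hz hCz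
    have := (abs_lt.1 (h₁ (4 * k) le_rfl)).1
    rw [S] at this
    linarith
  obtain ⟨hT4, hTB, hTlt⟩ := U.tau_spec hreach
  set T := U.tau k ω with hT
  have hj : |(U.Re T ω : ℝ) - k| ≤ z := by
    have hS := abs_lt.1 (h₁ T hT4)
    rw [S, hTB] at hS
    by_contra! hcon
    rcases lt_abs.1 hcon with hlt | hlt
    · have key := hreg.le_sub_of_le_of_add_le hc hk hu le_rfl (by linarith) hz hCz
      linarith
    · have key := hreg.le_sub_of_add_le hc (j := U.Re T ω) hk hv (by linarith) hz hCz
      linarith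
  have hTpos : 1 ≤ T := by
    by_contra! h0
    have : T = 0 := by omega
    rw [this, U.init_Bl] at hTB
    omega
  have hosc := h₂ T hT4 hTB (hTlt (T - 1) (by omega)).ne
  have hD : ∀ l, T ≤ l → l ≤ T + 4 * n → U.Bl l ω ≤ k + n →
      |(U.D l ω : ℝ) - (U.D T ω : ℝ)| < x := by
    intro l hl1 hl2 hBl
    have hBT : U.Bl T ω ≤ U.Bl l ω := U.Bl_mono ω hl1
    have hRT : U.Re T ω ≤ U.Re l ω := U.Re_mono ω hl1
    obtain ⟨m, hm⟩ := Nat.exists_eq_add_of_le hBT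
    obtain ⟨q, hq⟩ := Nat.exists_eq_add_of_le hRT
    have s1 := U.Bl_add_Re l ω
    have s2 := U.Bl_add_Re T ω
    have hS := hosc l hl1 hl2
    rw [S, S, hm, hq, hTB] at hS
    have := hreg.abs_sub_lt_of_abs_increment_lt hc hC (m := m) (q := q) hk hnk (by omega)
      (by omega) hzk hj hx hnz hS
    have e : (U.D l ω : ℝ) - (U.D T ω : ℝ) = (q : ℝ) - m := by
      rw [D, D, hm, hq]; push_cast; ring
    rwa [e]
  have hreach' : k + n ≤ U.Bl (T + 4 * n) ω := by
    by_contra! hlt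
    have hd := (abs_lt.1 (hD (T + 4 * n) (by omega) le_rfl hlt.le)).2
    have s1 := U.Bl_add_Re (T + 4 * n) ω
    have s2 := U.Bl_add_Re T ω
    have hBT : U.Bl T ω ≤ U.Bl (T + 4 * n) ω := U.Bl_mono ω (by omega)
    have : U.D T ω + n ≤ U.D (T + 4 * n) ω := by
      rw [D, D]; omega
    have : (U.D T ω : ℝ) + n ≤ U.D (T + 4 * n) ω := by exact_mod_cast this
    linarith
  obtain ⟨ha, hB, hlt⟩ := U.tau_spec hreach'
  refine hD i hi₁ (by omega) ?_
  have : U.Bl i ω ≤ U.Bl (U.tau (k + n) ω) ω := U.Bl_mono ω hi₂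
  omega

/-- Tail bound for the oscillation of the discrepancy, in terms of the levels `z` and `x`. -/
theorem measureReal_exists_le_abs_D_sub_le [IsProbabilityMeasure μ] (U : Urn μ b r)
    {κ : ℕ → ℝ} {c C : ℝ} (hb : ∀ i, 0 < b i)
    (hr : ∀ i, 0 < r i) (hc : 0 < c) (hC : 0 < C)
    (hreg : ScaleRegular (fun l => 1 / b l) (fun l => 1 / r l) κ c C) {k n : ℕ} (hk : 1 ≤ k)
    (hn : 1 ≤ n) (hnk : n ≤ k) {z x : ℝ} (hz : 0 ≤ z) (hzk : 2 * z ≤ k) (hCz : 4 * C ≤ c * z)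
    (hx : 0 ≤ x) (hxn : x ≤ n) (hnz : (n : ℝ) * (C * (z + 1) / k) ≤ c * x / 2) :
    μ.real {ω | ∃ i, U.tau k ω ≤ i ∧ i ≤ U.tau (k + n) ω ∧
        x ≤ |(U.D i ω : ℝ) - (U.D (U.tau k ω) ω : ℝ)|} ≤
      2 * Real.exp (-(c ^ 2 * z ^ 2 / (256 * k * C ^ 2)))
        + 2 * Real.exp (-(c ^ 2 * x ^ 2 / (64 * n * C ^ 2))) := by
  have hκ := hreg.scale_pos k hk
  have hK : 0 < C * κ k := by positivity
  have hk0 : (0 : ℝ) < k := by exact_mod_cast hk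
  have hn0 : (0 : ℝ) < n := by exact_mod_cast hn
  set E₁ : Set Ω := Set.univ ∩
    {ω | ∃ l, 0 ≤ l ∧ l ≤ 0 + 4 * k ∧ c * z / 4 * κ k ≤ |U.S l ω - U.S 0 ω|} with hE₁
  set A : ℕ → Set Ω := fun t => {ω | U.Bl t ω = k} ∩ {ω | U.Bl (t - 1) ω ≠ k} with hAdef
  set E₂ : ℕ → Set Ω := fun t => A t ∩
    {ω | ∃ l, t ≤ l ∧ l ≤ t + 4 * n ∧ c * x / 2 * κ k ≤ |U.S l ω - U.S t ω|} with hE₂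
  have hAF : ∀ t, MeasurableSet[U.F t] (A t) := fun t =>
    @MeasurableSet.inter _ (U.F t) _ _ (U.measurableSet_F_state le_rfl fun y => y.1 = k)
      (U.measurableSet_F_state (Nat.sub_le t 1) fun y => y.1 ≠ k)
  have hsub : {ω | ∃ i, U.tau k ω ≤ i ∧ i ≤ U.tau (k + n) ω ∧
      x ≤ |(U.D i ω : ℝ) - (U.D (U.tau k ω) ω : ℝ)|} ⊆
      E₁ ∪ ⋃ t ∈ Finset.range (4 * k + 1), E₂ t := by
    rintro ω ⟨i, hi1, hi2, hi3⟩
    by_contra hcon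
    simp only [Set.mem_union, Set.mem_iUnion, not_or, not_exists] at hcon
    obtain ⟨hcon1, hcon2⟩ := hcon
    refine not_lt.2 hi3 (U.abs_D_sub_lt hb hr hc hC hreg hk hn hnk hz hzk hCz hx hxn hnz ?_ ?_
      hi1 hi2)
    · intro l hl
      by_contra! hle
      exact hcon1 ⟨trivial, l, Nat.zero_le _, by omega, hle⟩
    · intro t ht hB hB' l hl1 hl2
      by_contra! hle
      exact hcon2 t (Finset.mem_range.2 (by omega)) ⟨⟨hB, hB'⟩, l, hl1, hl2, hle⟩
  have hm₁ : μ.real E₁ ≤ 2 * Real.exp (-(c ^ 2 * z ^ 2 / (256 * k * C ^ 2))) := by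
    have := U.measureReal_inter_exists_le_abs_S_sub hb hr hK (Q := 8 * k)
      (fun l hl => hreg.left_le k l hk hl) (fun l hl => hreg.right_le k l hk hl)
      (s := c * z / 4 * κ k) (by positivity) (N := 4 * k) (by omega) (t := 0) (i := 0) (j := 0)
      (A := Set.univ) (@MeasurableSet.univ _ (U.F 0))
      (fun ω _ => ⟨U.init_Bl ω, U.init_Re ω⟩) (by omega)
    rw [probReal_univ, one_mul] at this
    refine this.trans (le_of_eq ?_)
    congr 3
    push_cast
    field_simp
    norm_num
  set p₂ := 2 * Real.exp (-(c ^ 2 * x ^ 2 / (64 * n * C ^ 2))) with hp₂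
  have hm₂ : ∀ t ∈ Finset.range (4 * k + 1), μ.real (E₂ t) ≤ μ.real (A t) * p₂ := by
    intro t ht
    rcases lt_or_ge t k with htk | htk
    · have : A t = ∅ := by
        refine Set.eq_empty_of_forall_notMem fun ω hω => ?_
        have h1 : U.Bl t ω = k := hω.1
        have h2 := U.Bl_add_Re t ω
        omega
      simp [hE₂, this]
    have := U.measureReal_inter_exists_le_abs_S_sub hb hr hK (Q := 8 * k)
      (fun l hl => hreg.left_le k l hk hl) (fun l hl => hreg.right_le k l hk hl)
      (s := c * x / 2 * κ k) (by positivity) (N := 4 * n) (by omega) (t := t) (i := k)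
      (j := t - k) (hAF t)
      (fun ω hω => by
        have h1 : U.Bl t ω = k := hω.1
        have h2 := U.Bl_add_Re t ω
        omega) (by rw [Finset.mem_range] at ht; omega)
    refine this.trans (le_of_eq ?_)
    congr 4
    push_cast
    field_simp
    ring
  have hdisj : Set.PairwiseDisjoint (↑(Finset.range (4 * k + 1))) A := by
    have aux : ∀ s t, s < t → Disjoint (A s) (A t) := by
      intro s t hst
      refine Set.disjoint_left.2 fun ω hs ht => ht.2 ?_
      have h1 : U.Bl s ω = k := hs.1
      have h2 : U.Bl t ω = k := ht.1
      have h3 : U.Bl s ω ≤ U.Bl (t - 1) ω := U.Bl_mono ω (by omega)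
      have h4 : U.Bl (t - 1) ω ≤ U.Bl t ω := U.Bl_mono ω (by omega)
      change U.Bl (t - 1) ω = k
      omega
    intro s _ t _ hst
    rcases lt_or_gt_of_ne hst with h | h
    · exact aux s t h
    · exact (aux t s h).symm
  have hsumA : ∑ t ∈ Finset.range (4 * k + 1), μ.real (A t) ≤ 1 := by
    rw [← measureReal_biUnion_finset hdisj fun t _ => U.F_le t _ (hAF t)]
    exact measureReal_le_one
  refine (measureReal_mono hsub).trans ((measureReal_union_le _ _).trans (add_le_add hm₁ ?_))
  refine (measureReal_biUnion_finset_le _ _).trans ((Finset.sum_le_sum hm₂).trans ?_)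
  rw [← Finset.sum_mul]
  exact mul_le_of_le_one_left (by positivity) hsumA

end Urn

theorem sup_discrepancy_oscillation_tail {Ω : Type*} [MeasurableSpace Ω] (μ : MeasureTheory.Measure Ω) [MeasureTheory.IsProbabilityMeasure μ]
    (α B : ℝ) (hα : 0 < α) (w : ℕ → ℝ) (hw : ∀ n, 0 < w n)
    (hasymp : WeightAsymp w α B)
    (b r : ℕ → ℝ) (hb : ∀ i, 0 < b i) (hr : ∀ i, 0 < r i)
    (hchoice : UrnChoice w b r) (U : Urn μ b r) :
    ∃ M₀ : ℕ, ∃ c₄ > (0:ℝ), ∀ M : ℕ, M₀ ≤ M → ∀ n : ℕ, 1 ≤ n →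
      ∀ y : ℝ, 0 ≤ y → y ≤ Real.sqrt n →
        μ {ω | ∃ i : ℕ, U.tau (M*n) ω ≤ i ∧ i ≤ U.tau ((M+1)*n) ω ∧
              y * Real.sqrt n ≤ |(U.D i ω : ℝ) - (U.D (U.tau (M*n) ω) ω : ℝ)|}
          ≤ ENNReal.ofReal ((1/c₄) * Real.exp (-c₄ * y^2)) := by
  obtain ⟨κ, c, hc, C, hC, hreg⟩ := hchoice.exists_scaleRegular hα hasymp hb hr
  set ε : ℝ := min (1 / 2) (c / (4 * C)) with hε
  have hε0 : 0 < ε := lt_min (by norm_num) (by positivity)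
  have hε1 : ε ≤ 1 / 2 := min_le_left _ _
  have hε2 : 4 * C * ε ≤ c := by
    have := min_le_right (1 / 2) (c / (4 * C))
    rw [← hε, le_div_iff₀ (by positivity)] at this
    linarith
  set x₀ : ℝ := 4 * C / (c * ε) with hx₀
  have hx₀pos : 0 < x₀ := by positivity
  set c' : ℝ := c ^ 2 * ε ^ 2 / (256 * C ^ 2) with hc'
  have hc'pos : 0 < c' := by positivity
  set c₄ : ℝ := min c' (1 / (4 + x₀ ^ 2)) with hc₄
  have hc₄pos : 0 < c₄ := lt_min hc'pos (by positivity)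
  have hc₄le : c₄ * (4 + x₀ ^ 2) ≤ 1 := by
    rw [← le_div_iff₀ (by positivity)]; exact min_le_right _ _
  refine ⟨1, c₄, hc₄pos, fun M hM n hn y hy hyn => ?_⟩
  rw [← ENNReal.ofReal_toReal (measure_ne_top μ _)]
  refine ENNReal.ofReal_le_ofReal ?_
  change μ.real _ ≤ _
  have hn1 : (1 : ℝ) ≤ n := by exact_mod_cast hn
  have hM1 : (1 : ℝ) ≤ M := by exact_mod_cast hM
  have hn0 : (0 : ℝ) < n := by linarith
  have hM0 : (0 : ℝ) < M := by linarith
  have hsq : Real.sqrt n * Real.sqrt n = n := Real.mul_self_sqrt hn0.le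
  have hsq1 : 1 ≤ Real.sqrt n := Real.one_le_sqrt.2 hn1
  set x : ℝ := y * Real.sqrt n with hx
  have hx0 : 0 ≤ x := by positivity
  have hxn : x ≤ n := by
    rw [hx]; calc y * Real.sqrt n ≤ Real.sqrt n * Real.sqrt n := by gcongr
      _ = n := hsq
  have hx2 : x ^ 2 = y ^ 2 * n := by rw [hx, mul_pow, Real.sq_sqrt hn0.le]
  rcases lt_or_ge x x₀ with hsmall | hlarge
  · refine measureReal_le_one.trans ?_
    have hyx : y ≤ x₀ := (le_mul_of_one_le_right hy hsq1).trans hsmall.le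
    have h1 : y ^ 2 ≤ x₀ ^ 2 := by gcongr
    have h2 := Real.add_one_le_exp (-c₄ * y ^ 2)
    have h3 : c₄ * y ^ 2 ≤ c₄ * x₀ ^ 2 := by gcongr
    rw [one_div, inv_mul_eq_div, le_div_iff₀ hc₄pos]
    linarith
  · have hcεx : 4 * C ≤ c * ε * x := by
      rw [hx₀, div_le_iff₀ (by positivity)] at hlarge
      linarith
    have hcx : 4 * C ≤ c * x := by
      have : c * x * ε ≤ c * x * 1 := by gcongr; linarith
      linarith
    have hnM : n ≤ M * n := Nat.le_mul_of_pos_left n hM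
    have key := U.measureReal_exists_le_abs_D_sub_le hb hr hc hC hreg (k := M * n) (n := n)
      (z := ε * M * x) (x := x) (hn.trans hnM) hn hnM (by positivity)
      (by
        push_cast
        calc 2 * (ε * M * x) = (2 * ε) * (M * x) := by ring
          _ ≤ 1 * (M * n) := by gcongr; linarith
          _ = M * n := one_mul _)
      (by
        refine hcεx.trans ?_
        calc c * ε * x ≤ c * ε * (M * x) := by
              gcongr; exact le_mul_of_one_le_left hx0 hM1
          _ = _ := by ring)
      hx0 hxn
      (by
        push_cast
        have e : (n : ℝ) * (C * (ε * M * x + 1) / (M * n)) = C * ε * x + C / M := by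
          field_simp
        rw [e]
        have h1 : C / M ≤ C := div_le_self hC.le hM1
        have h2 : 4 * C * ε * x ≤ c * x := by gcongr
        linarith)
    rw [add_one_mul]
    refine key.trans ?_
    have e1 : c ^ 2 * (ε * M * x) ^ 2 / (256 * ((M * n : ℕ) : ℝ) * C ^ 2) = c' * y ^ 2 * M := by
      rw [mul_pow, hx2, hc']; push_cast; field_simp
    have e2 : c ^ 2 * x ^ 2 / (64 * n * C ^ 2) = c' * y ^ 2 * (4 / ε ^ 2) := by
      rw [hx2, hc']; field_simp; ring
    have hcy : c₄ * y ^ 2 ≤ c' * y ^ 2 := by gcongr; exact min_le_left _ _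
    have hcy0 : 0 ≤ c' * y ^ 2 := by positivity
    have hε4 : 1 ≤ 4 / ε ^ 2 := by
      rw [le_div_iff₀ (by positivity)]; nlinarith
    have b1 : Real.exp (-(c' * y ^ 2 * M)) ≤ Real.exp (-c₄ * y ^ 2) := by
      refine Real.exp_le_exp.2 ?_
      linarith [le_mul_of_one_le_right hcy0 hM1]
    have b2 : Real.exp (-(c' * y ^ 2 * (4 / ε ^ 2))) ≤ Real.exp (-c₄ * y ^ 2) := by
      refine Real.exp_le_exp.2 ?_
      linarith [le_mul_of_one_le_right hcy0 hε4]
    rw [e1, e2]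
    have h4 : 4 ≤ 1 / c₄ := by
      rw [le_div_iff₀ hc₄pos]
      nlinarith [sq_nonneg x₀, mul_nonneg hc₄pos.le (sq_nonneg x₀)]
    have := mul_le_mul_of_nonneg_right h4 (Real.exp_pos (-c₄ * y ^ 2)).le
    linarith
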